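/- Let ω_x > 0 and γ₋ ≥ 0, and consider the Liouvillian L(ρ) = −i[(ω_x/2)σ_x, ρ] + γ₋ D[σ₋]ρ on M₂(ℂ). Then: (a) L(σ_x) = −(γ₋/2)σ_x; (b) the eigenvalues of L, as a linear endomorphism of M₂(ℂ), are exactly 0, −γ₋/2, and −3γ₋/4 ± η/4, where η ∈ ℂ satisfies η² = γ₋² − 16ω_x²; (c) at γ₋ = 4ω_x, setting λ = −3γ₋/4 = −3ω_x, one has (L − λ·id)(σ_z) ≠ 0 and (L − λ·id)²(σ_z) = 0, so L has a second-order Liouvillian exceptional point at γ₋/ω_x = 4 — a different parameter value than the Hamiltonian exceptional point of the associated non-Hermitian Hamiltonian (ω_x/2)σ_x − i(γ₋/2)σ₊σ₋, which occurs at γ₋/ω_x = 2. -/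

import Mathlib

open Matrix Complex

noncomputable section

def σx : Matrix (Fin 2) (Fin 2) ℂ := !![0, 1; 1, 0]
def σz : Matrix (Fin 2) (Fin 2) ℂ := !![1, 0; 0, -1]
def σp : Matrix (Fin 2) (Fin 2) ℂ := !![0, 1; 0, 0]
def σm : Matrix (Fin 2) (Fin 2) ℂ := !![0, 0; 1, 0]

/-- The Lindblad dissipator `D[Γ]ρ = ΓρΓᴴ − (1/2)(ΓᴴΓρ + ρΓᴴΓ)`. -/
def dissip (Γ ρ : Matrix (Fin 2) (Fin 2) ℂ) : Matrix (Fin 2) (Fin 2) ℂ :=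
  Γ * ρ * Γᴴ - (2⁻¹ : ℂ) • (Γᴴ * Γ * ρ + ρ * (Γᴴ * Γ))

/-- The driven-qubit Liouvillian `L(ρ) = −i[(ω_x/2)σ_x, ρ] + γ₋ D[σ₋]ρ`. -/
def Ldriven (ωx γm : ℝ) (ρ : Matrix (Fin 2) (Fin 2) ℂ) :
    Matrix (Fin 2) (Fin 2) ℂ :=
  (-Complex.I) • (((ωx : ℂ) / 2) • σx * ρ - ρ * (((ωx : ℂ) / 2) • σx))
    + (γm : ℂ) • dissip σm ρ

lemma σm_conjTranspose : σmᴴ = σp := by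
  ext i j
  fin_cases i <;> fin_cases j <;> simp [σm, σp]

/-- The entries of the driven-qubit Liouvillian applied to a general matrix. -/
lemma Ldriven_apply_entries (ωx γm : ℝ) (a b c d : ℂ) :
    Ldriven ωx γm !![a, b; c, d] =
      !![-I * (ωx / 2) * (c - b) - γm * a, -I * (ωx / 2) * (d - a) - γm / 2 * b;
        -I * (ωx / 2) * (a - d) - γm / 2 * c, -I * (ωx / 2) * (b - c) + γm * a] := by
  rw [Ldriven, dissip, σm_conjTranspose, σx, σm, σp]
  ext i j
  fin_cases i <;> fin_cases j <;> simp <;> ring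

/-- The eigenvalue equation of the driven-qubit Liouvillian, entry by entry. -/
lemma Ldriven_eq_smul_iff (ωx γm : ℝ) (lam a b c d : ℂ) :
    Ldriven ωx γm !![a, b; c, d] = lam • !![a, b; c, d] ↔
      (-I * (ωx / 2) * (c - b) - γm * a = lam * a ∧
        -I * (ωx / 2) * (d - a) - γm / 2 * b = lam * b) ∧
      -I * (ωx / 2) * (a - d) - γm / 2 * c = lam * c ∧
        -I * (ωx / 2) * (b - c) + γm * a = lam * d := by
  rw [Ldriven_apply_entries, ← Matrix.ext_iff]
  simp [Fin.forall_fin_two]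

/-- Every eigenvalue of the driven-qubit Liouvillian is `0`, `-γm / 2` or a root of the
characteristic polynomial of the block acting on the `σy`, `σz` components. -/
lemma Ldriven_eigenvalue_cases {ωx γm : ℝ} {lam : ℂ} {ρ : Matrix (Fin 2) (Fin 2) ℂ}
    (hρ : ρ ≠ 0) (h : Ldriven ωx γm ρ = lam • ρ) :
    lam = 0 ∨ lam = -(γm : ℂ) / 2 ∨ (lam + γm / 2) * (lam + γm) + (ωx : ℂ) ^ 2 = 0 := by
  obtain ⟨a, b, c, d, rfl⟩ : ∃ a b c d : ℂ, ρ = !![a, b; c, d] :=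
    ⟨_, _, _, _, Matrix.eta_fin_two ρ⟩
  obtain ⟨⟨ha, hb⟩, hc, hd⟩ := (Ldriven_eq_smul_iff ..).1 h
  by_contra! hne
  obtain ⟨h0, h1, h2⟩ := hne
  have ht : a + d = 0 := by
    have : lam * (a + d) = 0 := by linear_combination -ha - hd
    exact (mul_eq_zero.1 this).resolve_left h0
  have hs : b + c = 0 := by
    have : (lam + γm / 2) * (b + c) = 0 := by linear_combination -hb - hc
    refine (mul_eq_zero.1 this).resolve_left fun h' => h1 ?_
    linear_combination h'
  obtain rfl : d = -a := by linear_combination ht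
  obtain rfl : c = -b := by linear_combination hs
  have ha0 : a = 0 := by
    refine (mul_eq_zero.1 (?_ : ((lam + γm / 2) * (lam + γm) + (ωx : ℂ) ^ 2) * a = 0)
      ).resolve_left h2
    linear_combination -(lam + γm / 2) * ha - I * ωx * hb + ωx ^ 2 * a * I_sq
  have hb0 : b = 0 := by
    refine (mul_eq_zero.1 (?_ : ((lam + γm / 2) * (lam + γm) + (ωx : ℂ) ^ 2) * b = 0)
      ).resolve_left h2
    linear_combination -(lam + γm) * hb - I * ωx * ha + ωx ^ 2 * b * I_sq
  subst ha0 hb0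
  apply hρ
  ext i j
  fin_cases i <;> fin_cases j <;> simp

/-- The steady state of the driven-qubit Liouvillian. -/
lemma Ldriven_steady_state (ωx γm : ℝ) :
    Ldriven ωx γm !![(ωx : ℂ) ^ 2, -I * ωx * γm; I * ωx * γm, (ωx : ℂ) ^ 2 + γm ^ 2] =
      (0 : ℂ) • !![(ωx : ℂ) ^ 2, -I * ωx * γm; I * ωx * γm, (ωx : ℂ) ^ 2 + γm ^ 2] := by
  rw [Ldriven_eq_smul_iff]
  refine ⟨⟨?_, ?_⟩, ?_, ?_⟩
  · linear_combination -(ωx : ℂ) ^ 2 * γm * I_sq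
  · ring
  · ring
  · linear_combination (ωx : ℂ) ^ 2 * γm * I_sq

/-- A root of the characteristic polynomial of the `σy`, `σz` block is an eigenvalue. -/
lemma Ldriven_eigenmatrix_of_root {ωx γm : ℝ} {lam : ℂ}
    (h : (lam + γm / 2) * (lam + γm) + (ωx : ℂ) ^ 2 = 0) :
    Ldriven ωx γm !![lam + γm / 2, I * ωx; -I * ωx, -(lam + γm / 2)] =
      lam • !![lam + γm / 2, I * ωx; -I * ωx, -(lam + γm / 2)] := by
  rw [Ldriven_eq_smul_iff]
  refine ⟨⟨?_, ?_⟩, ?_, ?_⟩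
  · linear_combination (ωx : ℂ) ^ 2 * I_sq - h
  · ring
  · ring
  · linear_combination -(ωx : ℂ) ^ 2 * I_sq + h

lemma Ldriven_σx (ωx γm : ℝ) : Ldriven ωx γm σx = (-(γm : ℂ) / 2) • σx := by
  rw [σx, Ldriven_eq_smul_iff]
  refine ⟨⟨?_, ?_⟩, ?_, ?_⟩ <;> ring

/-- For the driven-qubit Liouvillian:
(a) `L σ_x = −(γ₋/2)σ_x`;
(b) the eigenvalues of `L` are exactly `0`, `−γ₋/2`, and `−3γ₋/4 ± η/4` with
`η² = γ₋² − 16ω_x²`;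
(c) at `γ₋ = 4ω_x`, with `λ = −3ω_x`, `σ_z` is a generalized (but not true)
eigenmatrix: a second-order Liouvillian exceptional point at `γ₋/ω_x = 4`,
a different parameter value than the Hamiltonian exceptional point
(at `γ₋/ω_x = 2`) of `(ω_x/2)σ_x − i(γ₋/2)σ₊σ₋`. -/
theorem driven_qubit_LEP (ωx γm : ℝ) (hωx : 0 < ωx) (hγm : 0 ≤ γm) :
    (Ldriven ωx γm σx = (-(γm : ℂ) / 2) • σx) ∧
    (∀ η : ℂ, η ^ 2 = (γm : ℂ) ^ 2 - 16 * (ωx : ℂ) ^ 2 →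
      ∀ lam : ℂ,
        (∃ ρ : Matrix (Fin 2) (Fin 2) ℂ, ρ ≠ 0 ∧ Ldriven ωx γm ρ = lam • ρ) ↔
          (lam = 0 ∨ lam = -(γm : ℂ) / 2 ∨
            lam = -3 * (γm : ℂ) / 4 + η / 4 ∨
            lam = -3 * (γm : ℂ) / 4 - η / 4)) ∧
    (γm = 4 * ωx →
      Ldriven ωx γm σz - (-3 * (ωx : ℂ)) • σz ≠ 0 ∧
      Ldriven ωx γm (Ldriven ωx γm σz - (-3 * (ωx : ℂ)) • σz)
          - (-3 * (ωx : ℂ)) • (Ldriven ωx γm σz - (-3 * (ωx : ℂ)) • σz) = 0) := by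
  have hω : (ωx : ℂ) ≠ 0 := by exact_mod_cast hωx.ne'
  refine ⟨Ldriven_σx ωx γm, fun η hη lam => ?_, fun hγ => ?_⟩
  · have hfac : (lam + γm / 2) * (lam + γm) + (ωx : ℂ) ^ 2 =
        (lam - (-3 * (γm : ℂ) / 4 + η / 4)) * (lam - (-3 * (γm : ℂ) / 4 - η / 4)) := by
      linear_combination hη / 16
    have hroot : (lam + γm / 2) * (lam + γm) + (ωx : ℂ) ^ 2 = 0 ↔
        lam = -3 * (γm : ℂ) / 4 + η / 4 ∨ lam = -3 * (γm : ℂ) / 4 - η / 4 := by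
      rw [hfac, mul_eq_zero, sub_eq_zero, sub_eq_zero]
    rw [← hroot]
    constructor
    · rintro ⟨ρ, hρ, h⟩
      exact Ldriven_eigenvalue_cases hρ h
    · rintro (rfl | rfl | h)
      · refine ⟨_, fun h0 => ?_, Ldriven_steady_state ωx γm⟩
        simpa [hω] using congr_fun₂ h0 0 0
      · refine ⟨_, fun h0 => ?_, Ldriven_σx ωx γm⟩
        simpa [σx] using congr_fun₂ h0 0 1
      · refine ⟨_, fun h0 => ?_, Ldriven_eigenmatrix_of_root h⟩
        simpa [hω] using congr_fun₂ h0 0 1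
  · subst hγ
    have hN : Ldriven ωx (4 * ωx) σz - (-3 * (ωx : ℂ)) • σz =
        !![-(ωx : ℂ), I * ωx; -I * ωx, ωx] := by
      rw [σz, Ldriven_apply_entries]
      ext i j
      fin_cases i <;> fin_cases j <;> simp <;> ring
    rw [hN]
    refine ⟨fun h0 => ?_, ?_⟩
    · simpa [hω] using congr_fun₂ h0 0 0
    · rw [sub_eq_zero, Ldriven_eq_smul_iff]
      push_cast
      refine ⟨⟨?_, ?_⟩, ?_, ?_⟩
      · linear_combination (ωx : ℂ) ^ 2 * I_sq
      · ring
      · ring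
      · linear_combination -(ωx : ℂ) ^ 2 * I_sq

end
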